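/- arXiv:2204.13381 — 3 statements merged into one kernel-verified Lean document; each statement's English description precedes it below -/
import Mathlib

section
/- Let M be a vector space over ℂ, n ≥ 1, and f₁, …, fₙ : M →ₗ[ℂ] M pairwise commuting linear endomorphisms. Then the following are equivalent: (a) for every index i and every m ∈ M there exists a nonzero polynomial b ∈ ℂ[X], all of whose complex roots are real, such that (aeval fᵢ b) m = 0; (b) M is the internal direct sum of the family of joint generalized eigenspaces (M^β)_{β ∈ ℝⁿ}, where for β = (β₁, …, βₙ) one sets M^β := ⋂_{i=1}^{n} ⋃_{l ≥ 0} ker((fᵢ − βᵢ·id)^l). -/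
open Polynomial in
/-- An element of an invariant submodule which is annihilated by a product of powers of distinct
linear polynomials in `f` decomposes, inside the submodule, along generalized eigenspaces. -/
theorem Module.End.mem_iSup_inf_maxGenEigenspace_of_aeval_prod_eq_zero {K M : Type*} [Field K]
    [AddCommGroup M] [Module K M] (f : Module.End K M) {p : Submodule K M}
    (hp : p ∈ f.invtSubmodule) (e : K → ℕ) (s : Finset K) {m : M} (hm : m ∈ p)
    (h : aeval f (∏ a ∈ s, (X - C a) ^ e a) m = 0) :
    m ∈ ⨆ a ∈ s, p ⊓ f.maxGenEigenspace a := by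
  classical
  induction s using Finset.induction_on generalizing m with
  | empty => simpa using h
  | insert a s ha ih =>
    rw [Finset.prod_insert ha] at h
    have hcop : IsCoprime ((X - C a) ^ e a) (∏ b ∈ s, (X - C b) ^ e b) :=
      IsCoprime.prod_right fun b hb ↦
        (isCoprime_X_sub_C_of_isUnit_sub
          (sub_ne_zero.2 (ne_of_mem_of_not_mem hb ha).symm).isUnit).pow
    obtain ⟨u, v, huv⟩ := hcop
    set P := (X - C a) ^ e a with hP
    set Q := ∏ b ∈ s, (X - C b) ^ e b
    have hinv (q : K[X]) : aeval f q m ∈ p :=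
      aeval_apply_smul_mem_of_le_comap hm q f hp
    have hsum : m = aeval f (v * Q) m + aeval f (u * P) m := by
      rw [← LinearMap.add_apply, ← map_add, add_comm, huv, map_one, Module.End.one_apply]
    have hv : aeval f P (aeval f (v * Q) m) = 0 := by
      rw [← Module.End.mul_apply, ← map_mul, show P * (v * Q) = v * (P * Q) by ring, map_mul,
        Module.End.mul_apply, h, map_zero]
    have hu : aeval f Q (aeval f (u * P) m) = 0 := by
      rw [← Module.End.mul_apply, ← map_mul, show Q * (u * P) = u * (P * Q) by ring, map_mul,
        Module.End.mul_apply, h, map_zero]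
    rw [Finset.iSup_insert, hsum]
    refine Submodule.add_mem_sup ⟨hinv _, ?_⟩ (ih (hinv _) hu)
    refine (f.mem_maxGenEigenspace a _).2 ⟨e a, ?_⟩
    simpa [hP, Algebra.algebraMap_eq_smul_one] using hv

open Polynomial in
/-- An invariant submodule whose elements are annihilated by polynomials in `f` with only real
roots is spanned by its intersections with generalized eigenspaces for real eigenvalues. -/
theorem Module.End.le_iSup_inf_maxGenEigenspace_ofReal {M : Type*} [AddCommGroup M] [Module ℂ M]
    (f : Module.End ℂ M) {p : Submodule ℂ M} (hp : p ∈ f.invtSubmodule)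
    (h : ∀ m ∈ p, ∃ b : ℂ[X], b ≠ 0 ∧ (∀ z ∈ b.roots, z.im = 0) ∧ aeval f b m = 0) :
    p ≤ ⨆ r : ℝ, p ⊓ f.maxGenEigenspace (r : ℂ) := by
  classical
  intro m hm
  obtain ⟨b, hb, hroots, hbm⟩ := h m hm
  have hprod : aeval f (∏ a ∈ b.roots.toFinset, (X - C a) ^ b.roots.count a) m = 0 := by
    rw [(IsAlgClosed.splits b).eq_prod_roots, map_mul, aeval_C, Module.End.mul_apply,
      Module.algebraMap_end_apply] at hbm
    rw [← Finset.prod_multiset_map_count]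
    exact (smul_eq_zero.1 hbm).resolve_left (leadingCoeff_ne_zero.2 hb)
  refine (iSup₂_le fun a ha ↦ ?_ : (⨆ a ∈ b.roots.toFinset, p ⊓ f.maxGenEigenspace a) ≤ _)
    (f.mem_iSup_inf_maxGenEigenspace_of_aeval_prod_eq_zero hp _ _ hm hprod)
  have hre : ((a.re : ℝ) : ℂ) = a :=
    Complex.ext rfl (hroots a (Multiset.mem_toFinset.1 ha)).symm
  exact hre ▸ le_iSup (fun r : ℝ ↦ p ⊓ f.maxGenEigenspace (r : ℂ)) a.re

open Polynomial in
/-- If every vector is annihilated by a polynomial with only real roots in each member of a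
commuting family, then the joint generalized eigenspaces for finitely many members span. -/
theorem Module.End.iSup_biInf_maxGenEigenspace_ofReal_eq_top {ι M : Type*} [AddCommGroup M]
    [Module ℂ M] (f : ι → Module.End ℂ M) (hcomm : ∀ i j, Commute (f i) (f j))
    (h : ∀ i m, ∃ b : ℂ[X], b ≠ 0 ∧ (∀ z ∈ b.roots, z.im = 0) ∧ aeval (f i) b m = 0)
    (s : Finset ι) :
    ⨆ β : ι → ℝ, ⨅ i ∈ s, (f i).maxGenEigenspace (β i : ℂ) = ⊤ := by
  classical
  induction s using Finset.induction_on with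
  | empty => simp
  | insert j s hj ih =>
    rw [eq_top_iff, ← ih]
    refine iSup_le fun β ↦ ?_
    have hinv : (⨅ i ∈ s, (f i).maxGenEigenspace (β i : ℂ)) ∈ (f j).invtSubmodule := by
      intro x hx
      simp only [Submodule.mem_comap, Submodule.mem_iInf] at hx ⊢
      exact fun i hi ↦ mapsTo_maxGenEigenspace_of_comm (hcomm i j) _ (hx i hi)
    refine ((f j).le_iSup_inf_maxGenEigenspace_ofReal hinv fun m _ ↦ h j m).trans
      (iSup_le fun r ↦ le_iSup_of_le (Function.update β j r) ?_)
    rw [Finset.iInf_insert, Function.update_self, inf_comm]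
    refine inf_le_inf_left _ (iInf₂_mono fun i hi ↦ ?_)
    rw [Function.update_of_ne (ne_of_mem_of_not_mem hi hj)]

open Polynomial in
/-- Vectors in the span of the generalized eigenspaces of `f` for real eigenvalues are annihilated
by polynomials in `f` with only real roots. -/
theorem Module.End.exists_aeval_eq_zero_of_mem_iSup_maxGenEigenspace_ofReal {M : Type*}
    [AddCommGroup M] [Module ℂ M] (f : Module.End ℂ M) {m : M}
    (hm : m ∈ ⨆ r : ℝ, f.maxGenEigenspace (r : ℂ)) :
    ∃ b : ℂ[X], b ≠ 0 ∧ (∀ z ∈ b.roots, z.im = 0) ∧ aeval f b m = 0 := by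
  induction hm using Submodule.iSup_induction' with
  | mem r x hx =>
    obtain ⟨k, hk⟩ := (f.mem_maxGenEigenspace _ _).1 hx
    refine ⟨(X - C (r : ℂ)) ^ k, pow_ne_zero _ (X_sub_C_ne_zero _), fun z hz ↦ ?_, ?_⟩
    · rw [roots_pow, roots_X_sub_C] at hz
      rw [Multiset.mem_singleton.1 (Multiset.mem_of_mem_nsmul hz), Complex.ofReal_im]
    · simpa [Algebra.algebraMap_eq_smul_one] using hk
  | zero => exact ⟨1, one_ne_zero, by simp, map_zero _⟩
  | add x y _ _ ihx ihy =>
    obtain ⟨b, hb, hbr, hbx⟩ := ihx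
    obtain ⟨c, hc, hcr, hcy⟩ := ihy
    refine ⟨b * c, mul_ne_zero hb hc, fun z hz ↦ ?_, ?_⟩
    · rw [roots_mul (mul_ne_zero hb hc), Multiset.mem_add] at hz
      exact hz.elim (hbr z) (hcr z)
    · rw [map_add, map_mul, Module.End.mul_apply, Module.End.mul_apply, hcy, map_zero, add_zero,
        ← Module.End.mul_apply, ← map_mul, mul_comm, map_mul, Module.End.mul_apply, hbx, map_zero]

/-- Pairwise commuting endomorphisms `f₁, …, fₙ` of a complex vector space `M` are
"simultaneously monodromic" (every element is annihilated, for each `i`, by a nonzero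
polynomial in `fᵢ` with only real roots) if and only if `M` is the internal direct sum
of the joint generalized eigenspaces `M^β = ⋂ᵢ ⋃ l, ker ((fᵢ - βᵢ)^l)` over `β ∈ ℝⁿ`. -/
theorem stmt1 (M : Type*) [AddCommGroup M] [Module ℂ M] (n : ℕ) (hn : 1 ≤ n)
    (f : Fin n → M →ₗ[ℂ] M) (hcomm : ∀ i j, Commute (f i) (f j)) :
    (∀ (i : Fin n) (m : M), ∃ b : Polynomial ℂ, b ≠ 0 ∧ (∀ z ∈ b.roots, z.im = 0) ∧
      Polynomial.aeval (f i) b m = 0) ↔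
    (iSupIndep (fun β : Fin n → ℝ =>
        ⨅ i, Module.End.maxGenEigenspace (f i) (β i : ℂ)) ∧
      (⨆ β : Fin n → ℝ, ⨅ i, Module.End.maxGenEigenspace (f i) (β i : ℂ)) = ⊤) := by
  refine ⟨fun h ↦ ⟨?_, ?_⟩, fun h i m ↦ ?_⟩
  · exact (Module.End.independent_iInf_maxGenEigenspace_of_forall_mapsTo f fun i j φ ↦
      Module.End.mapsTo_maxGenEigenspace_of_comm (hcomm j i) φ).comp
      (f := fun (β : Fin n → ℝ) i ↦ (β i : ℂ)) fun β γ hβγ ↦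
        funext fun i ↦ Complex.ofReal_injective (congrFun hβγ i)
  · simpa using Module.End.iSup_biInf_maxGenEigenspace_ofReal_eq_top f hcomm h Finset.univ
  · refine Module.End.exists_aeval_eq_zero_of_mem_iSup_maxGenEigenspace_ofReal (f i) ?_
    have hle : (⨆ β : Fin n → ℝ, ⨅ i, Module.End.maxGenEigenspace (f i) (β i : ℂ)) ≤
        ⨆ r : ℝ, Module.End.maxGenEigenspace (f i) (r : ℂ) :=
      iSup_le fun β ↦ (iInf_le _ i).trans
        (le_iSup (fun r : ℝ ↦ Module.End.maxGenEigenspace (f i) (r : ℂ)) (β i))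
    exact hle (h.2 ▸ Submodule.mem_top)
end

section
/- Let M be a vector space over ℂ, n ≥ 1, and f₁, …, fₙ : M →ₗ[ℂ] M pairwise commuting linear endomorphisms such that M is the internal direct sum of the joint generalized eigenspaces M^β := ⋂_{i=1}^{n} ⋃_{l ≥ 0} ker((fᵢ − βᵢ·id)^l) over β = (β₁, …, βₙ) ∈ ℝⁿ. Then for every γ ∈ ℝ the generalized eigenspace of the sum satisfies ⋃_{l ≥ 0} ker((f₁ + ⋯ + fₙ − γ·id)^l) = ⨆ { M^β : β ∈ ℝⁿ, β₁ + ⋯ + βₙ = γ }. -/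
namespace Module.End

variable {R M : Type*} [CommRing R] [AddCommGroup M] [Module R M]

lemma iInf_maxGenEigenspace_le_sum {ι : Type*} (s : Finset ι) (f : ι → End R M)
    (h : ∀ i j, Commute (f i) (f j)) (χ : ι → R) :
    ⨅ i ∈ s, (f i).maxGenEigenspace (χ i) ≤ (∑ i ∈ s, f i).maxGenEigenspace (∑ i ∈ s, χ i) := by
  classical
  induction s using Finset.induction_on with
  | empty =>
    intro m _
    exact (mem_maxGenEigenspace _ _ _).mpr ⟨1, by simp⟩
  | insert a s ha ih =>
    rw [Finset.iInf_insert, Finset.sum_insert ha, Finset.sum_insert ha]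
    exact (inf_le_inf_left _ ih).trans <|
      genEigenspace_inf_le_add _ _ _ _ _ _ (Commute.sum_right _ _ _ fun i _ ↦ h a i)

end Module.End


/-- If a complex vector space `M` is the internal direct sum of the joint generalized
eigenspaces of pairwise commuting endomorphisms `f₁, …, fₙ`, then for every `γ ∈ ℝ`
the generalized eigenspace of `f₁ + ⋯ + fₙ` for the eigenvalue `γ` is the supremum of
the joint generalized eigenspaces `M^β` over all `β ∈ ℝⁿ` with `β₁ + ⋯ + βₙ = γ`. -/
theorem stmt2 (M : Type*) [AddCommGroup M] [Module ℂ M] (n : ℕ) (hn : 1 ≤ n)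
    (f : Fin n → M →ₗ[ℂ] M) (hcomm : ∀ i j, Commute (f i) (f j))
    (hind : iSupIndep (fun β : Fin n → ℝ =>
        ⨅ i, Module.End.maxGenEigenspace (f i) (β i : ℂ)))
    (hsup : (⨆ β : Fin n → ℝ, ⨅ i, Module.End.maxGenEigenspace (f i) (β i : ℂ)) = ⊤)
    (γ : ℝ) :
    Module.End.maxGenEigenspace (∑ i, f i) (γ : ℂ) =
      ⨆ β ∈ {β : Fin n → ℝ | ∑ i, β i = γ},
        ⨅ i, Module.End.maxGenEigenspace (f i) (β i : ℂ) := by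
  set V : (Fin n → ℝ) → Submodule ℂ M :=
    fun β ↦ ⨅ i, Module.End.maxGenEigenspace (f i) (β i : ℂ)
  set G : ℂ → Submodule ℂ M := fun c ↦ Module.End.maxGenEigenspace (∑ i, f i) c
  have hle (β : Fin n → ℝ) : V β ≤ G ((∑ i, β i : ℝ) : ℂ) := by
    simpa [V, G] using
      Module.End.iInf_maxGenEigenspace_le_sum Finset.univ f hcomm fun i ↦ (β i : ℂ)
  set N := ⨆ β ∈ {β : Fin n → ℝ | ∑ i, β i = γ}, V β
  set C := ⨆ c, ⨆ (_ : c ≠ (γ : ℂ)), G c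
  have hN : N ≤ G γ := iSup₂_le fun β hβ ↦ by
    simpa only [show ∑ i, β i = γ from hβ] using hle β
  have htop : N ⊔ C = ⊤ := by
    rw [eq_top_iff, ← hsup]
    refine iSup_le fun β ↦ ?_
    by_cases hβ : ∑ i, β i = γ
    · exact le_sup_of_le_left (le_iSup₂_of_le β hβ le_rfl)
    · exact le_sup_of_le_right (le_iSup₂_of_le _ (by exact_mod_cast hβ) (hle β))
  have hdisj : Disjoint (G γ) C := Module.End.independent_maxGenEigenspace (∑ i, f i) (γ : ℂ)
  change G γ = N
  calc G γ = (N ⊔ C) ⊓ G γ := by rw [htop, top_inf_eq]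
    _ = N ⊔ C ⊓ G γ := sup_inf_assoc_of_le C hN
    _ = N := by rw [hdisj.symm.eq_bot, sup_bot_eq]
end

section
/- Let M be a vector space over ℂ and a, b : M →ₗ[ℂ] M linear endomorphisms satisfying b ∘ a − a ∘ b = id. Set N := a ∘ b, and for β ∈ ℂ write E_β := ⋃_{l ≥ 0} ker((N − β·id)^l). Then: (1) if β ≠ −1, the map a restricts to a bijection from E_β onto E_{β+1}; (2) if β ≠ 0, the map b restricts to a bijection from E_β onto E_{β−1}. -/
open Polynomial in
/-- Away from its eigenvalue, `f - c` permutes a generalized eigenspace of `f`. -/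
theorem Module.End.bijOn_sub_smul_maxGenEigenspace {K V : Type*} [Field K] [AddCommGroup V]
    [Module K V] (f : Module.End K V) {c μ : K} (hc : c ≠ μ) :
    Set.BijOn (f - c • (1 : Module.End K V)) (f.maxGenEigenspace μ : Set V)
      (f.maxGenEigenspace μ : Set V) := by
  have aeval_sub (d : K) : aeval f (X - C d) = f - d • (1 : Module.End K V) := by
    simp [Algebra.algebraMap_eq_smul_one]
  have maps (p : K[X]) : Set.MapsTo (aeval f p) (f.maxGenEigenspace μ : Set V)
      (f.maxGenEigenspace μ : Set V) :=
    mapsTo_maxGenEigenspace_of_comm (by simpa using (Commute.all X p).map (aeval f)) μ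
  have inverse (x : V) (hx : x ∈ f.maxGenEigenspace μ) :
      ∃ u : K[X], aeval f u ((f - c • (1 : Module.End K V)) x) = x ∧
        (f - c • (1 : Module.End K V)) (aeval f u x) = x := by
    obtain ⟨k, hk⟩ := (mem_maxGenEigenspace f μ x).1 hx
    obtain ⟨u, v, huv⟩ : IsCoprime (X - C c) ((X - C μ) ^ k) :=
      (isCoprime_X_sub_C_of_isUnit_sub (sub_ne_zero.2 hc).isUnit).pow_right
    have key : aeval f (u * (X - C c)) x = x := by
      have := congrArg (fun p => aeval f p x) huv
      simpa only [map_add, map_mul, map_pow, aeval_sub, LinearMap.add_apply, Module.End.mul_apply,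
        hk, map_zero, add_zero, map_one, Module.End.one_apply] using this
    refine ⟨u, ?_, ?_⟩
    · rwa [map_mul, aeval_sub] at key
    · rwa [mul_comm, map_mul, aeval_sub] at key
  refine ⟨aeval_sub c ▸ maps (X - C c), ?_, ?_⟩
  · intro x hx y hy hxy
    obtain ⟨u, hu, -⟩ := inverse (x - y) (sub_mem hx hy)
    rw [map_sub, hxy, sub_self, map_zero] at hu
    exact sub_eq_zero.1 hu.symm
  · intro x hx
    obtain ⟨u, -, hu⟩ := inverse x hx
    exact ⟨_, maps u hx, hu⟩

/-- An intertwiner of `f - μ` and `g - ν` maps generalized eigenvectors to generalized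
eigenvectors. -/
theorem Module.End.mapsTo_maxGenEigenspace_of_semiconjBy {R V : Type*} [CommRing R]
    [AddCommGroup V] [Module R V] {f g t : Module.End R V} {μ ν : R}
    (h : SemiconjBy t (f - μ • (1 : Module.End R V)) (g - ν • (1 : Module.End R V))) :
    Set.MapsTo t (f.maxGenEigenspace μ : Set V) (g.maxGenEigenspace ν : Set V) := by
  intro x hx
  obtain ⟨k, hk⟩ := (mem_maxGenEigenspace f μ x).1 hx
  refine (mem_maxGenEigenspace g ν _).2 ⟨k, ?_⟩
  rw [← Module.End.mul_apply, ← (h.pow_right k).eq, Module.End.mul_apply, hk, map_zero]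

theorem Set.BijOn.of_comp_of_comp {α β : Type*} {f : α → β} {g : β → α} {s : Set α} {t : Set β}
    (hf : Set.MapsTo f s t) (hg : Set.MapsTo g t s) (hgf : Set.BijOn (g ∘ f) s s)
    (hfg : Set.BijOn (f ∘ g) t t) : Set.BijOn f s t := by
  refine ⟨hf, fun x hx y hy hxy => hgf.injOn hx hy (congrArg g hxy), fun y hy => ?_⟩
  obtain ⟨z, hz, rfl⟩ := hfg.surjOn hy
  exact ⟨g z, hg hz, rfl⟩

/-- If `b * a - a * b = 1` and `β ≠ -1`, then `a` and `b` are bijections, in opposite directions,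
between the generalized eigenspaces of `a * b` at `β` and `β + 1`. -/
theorem Module.End.bijOn_maxGenEigenspace_of_mul_sub_mul_eq_one {K V : Type*} [Field K]
    [AddCommGroup V] [Module K V] {a b : Module.End K V} (h : b * a - a * b = 1) {β : K}
    (hβ : β ≠ -1) :
    Set.BijOn a ((a * b).maxGenEigenspace β : Set V) ((a * b).maxGenEigenspace (β + 1) : Set V) ∧
    Set.BijOn b ((a * b).maxGenEigenspace (β + 1) : Set V)
      ((a * b).maxGenEigenspace β : Set V) := by
  have hba : b * a = a * b + 1 := by rw [← h]; abel
  have ha : Set.MapsTo a ((a * b).maxGenEigenspace β : Set V)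
      ((a * b).maxGenEigenspace (β + 1) : Set V) := by
    apply mapsTo_maxGenEigenspace_of_semiconjBy
    rw [SemiconjBy, sub_mul, mul_assoc a b a, hba]
    simp only [mul_sub, mul_add, mul_one, mul_smul_comm, smul_mul_assoc, one_mul, add_smul,
      one_smul, add_mul]
    abel
  have hb : Set.MapsTo b ((a * b).maxGenEigenspace (β + 1) : Set V)
      ((a * b).maxGenEigenspace β : Set V) := by
    apply mapsTo_maxGenEigenspace_of_semiconjBy
    rw [SemiconjBy, mul_sub, ← mul_assoc b a b, hba]
    simp only [sub_mul, add_mul, mul_one, mul_smul_comm, smul_mul_assoc, one_mul, add_smul,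
      one_smul, mul_add]
    abel
  have hab_bij : Set.BijOn (a ∘ b) ((a * b).maxGenEigenspace (β + 1) : Set V)
      ((a * b).maxGenEigenspace (β + 1) : Set V) := by
    have hne : (0 : K) ≠ β + 1 := fun h0 => hβ (eq_neg_of_add_eq_zero_left h0.symm)
    simpa [Module.End.coe_mul] using bijOn_sub_smul_maxGenEigenspace (a * b) hne
  have hba_bij : Set.BijOn (b ∘ a) ((a * b).maxGenEigenspace β : Set V)
      ((a * b).maxGenEigenspace β : Set V) := by
    have := bijOn_sub_smul_maxGenEigenspace (a * b) hβ.symm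
    rwa [neg_smul, one_smul, sub_neg_eq_add, ← hba, Module.End.coe_mul] at this
  exact ⟨.of_comp_of_comp ha hb hba_bij hab_bij, .of_comp_of_comp hb ha hab_bij hba_bij⟩

/-- For endomorphisms `a`, `b` of a complex vector space with `b ∘ a - a ∘ b = id` and
`N = a ∘ b`: if `β ≠ -1` then `a` restricts to a bijection from the generalized
eigenspace of `N` at `β` onto the one at `β + 1`, and if `β ≠ 0` then `b` restricts to
a bijection from the generalized eigenspace at `β` onto the one at `β - 1`. -/
theorem stmt4 (M : Type*) [AddCommGroup M] [Module ℂ M] (a b : M →ₗ[ℂ] M)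
    (h : b ∘ₗ a - a ∘ₗ b = LinearMap.id) (β : ℂ) :
    (β ≠ -1 → Set.BijOn a
      (Module.End.maxGenEigenspace (a ∘ₗ b) β : Set M)
      (Module.End.maxGenEigenspace (a ∘ₗ b) (β + 1) : Set M)) ∧
    (β ≠ 0 → Set.BijOn b
      (Module.End.maxGenEigenspace (a ∘ₗ b) β : Set M)
      (Module.End.maxGenEigenspace (a ∘ₗ b) (β - 1) : Set M)) := by
  refine ⟨fun hβ => (Module.End.bijOn_maxGenEigenspace_of_mul_sub_mul_eq_one h hβ).1,
    fun hβ => ?_⟩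
  have hne : β - 1 ≠ -1 := fun h0 => hβ (by linear_combination h0)
  have := (Module.End.bijOn_maxGenEigenspace_of_mul_sub_mul_eq_one h hne).2
  rwa [sub_add_cancel] at this
end
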